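/- (Diagonal invariants Hilbert series quotient) Let G = C_m ≀ S_n act on P_n^{⊗t} = (ℂ[x_1,...,x_n])^{⊗t} diagonally (via φ_D) and let G^t act by the tensor action φ_T. Let F_D(q̄) and F_T(q̄) be the multigraded Hilbert series of the diagonal invariant algebra DIA and the tensor invariant algebra TIA respectively. Then F_D(q̄)/F_T(q̄) = Σ_{π_1 ⋯ π_t = 1} Π_{i=1}^t q_i^{flag-major(π_i)}, the sum over all t-tuples (π_1,...,π_t) ∈ G^t whose product is the identity. -/

import Mathlib

open Finset

@[ext]
structure GenPerm (m n : ℕ) where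
  σ : Equiv.Perm (Fin n)
  c : Fin n → ZMod m
deriving DecidableEq

namespace GenPerm

variable {m n : ℕ}

instance [NeZero m] : Fintype (GenPerm m n) :=
  Fintype.ofEquiv (Equiv.Perm (Fin n) × (Fin n → ZMod m))
    { toFun := fun p => ⟨p.1, p.2⟩
      invFun := fun g => (g.σ, g.c)
      left_inv := fun p => rfl
      right_inv := fun g => rfl }

instance : Mul (GenPerm m n) := ⟨fun g h => ⟨g.σ * h.σ, fun j => g.c (h.σ j) + h.c j⟩⟩
instance : One (GenPerm m n) := ⟨⟨1, 0⟩⟩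
instance : Inv (GenPerm m n) := ⟨fun g => ⟨g.σ⁻¹, fun j => - g.c (g.σ⁻¹ j)⟩⟩

@[simp] lemma mul_σ (g h : GenPerm m n) : (g * h).σ = g.σ * h.σ := rfl
@[simp] lemma mul_c (g h : GenPerm m n) (j : Fin n) : (g * h).c j = g.c (h.σ j) + h.c j := rfl
@[simp] lemma one_σ : (1 : GenPerm m n).σ = 1 := rfl
@[simp] lemma one_c (j : Fin n) : (1 : GenPerm m n).c j = 0 := rfl
@[simp] lemma inv_σ (g : GenPerm m n) : (g⁻¹).σ = g.σ⁻¹ := rfl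
@[simp] lemma inv_c (g : GenPerm m n) (j : Fin n) : (g⁻¹).c j = - g.c (g.σ⁻¹ j) := rfl

instance : Group (GenPerm m n) where
  mul_assoc a b c := by
    ext j
    · simp [mul_assoc]
    · simp [add_assoc]
  one_mul a := by
    ext j
    · simp
    · simp
  mul_one a := by
    ext j
    · simp
    · simp
  inv_mul_cancel a := by
    ext j
    · simp
    · simp

/-- The generator `s i`: `s 0` multiplies the first letter's phase by `ω`;
for `1 ≤ i < n`, `s i` swaps positions `i` and `i+1` (1-indexed), i.e. `i-1` and `i`
(0-indexed). -/
def s (i : ℕ) : GenPerm m n :=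
  if h : i < n then
    if h0 : i = 0 then ⟨1, fun j => if j = ⟨0, by omega⟩ then 1 else 0⟩
    else ⟨Equiv.swap ⟨i - 1, by omega⟩ ⟨i, h⟩, 0⟩
  else 1

/-- `t i = s i * s (i-1) * ⋯ * s 1 * s 0`. -/
def t (i : ℕ) : GenPerm m n := ((List.range (i + 1)).map (fun j => (s (i - j) : GenPerm m n))).prod

/-- `rep k = t (n-1) ^ k (n-1) * ⋯ * t 0 ^ k 0`. -/
def rep (k : Fin n → ℕ) : GenPerm m n :=
  (List.ofFn (fun i : Fin n => (t (i : ℕ) : GenPerm m n) ^ k i)).reverse.prod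

open scoped Classical in
/-- The flag major index: the sum of the exponents in the canonical representation
`π = t (n-1) ^ k (n-1) * ⋯ * t 0 ^ k 0` with `0 ≤ k i < m * (i+1)`. -/
noncomputable def flagMajor (π : GenPerm m n) : ℕ :=
  if h : ∃ k : Fin n → ℕ, (∀ i : Fin n, k i < m * ((i : ℕ) + 1)) ∧ π = rep k
  then ∑ i, h.choose i else 0

/-- The major index of a generalized permutation with respect to the linear order
`1·ω^{m-1} < ⋯ < n·ω^{m-1} < ⋯ < 1·ω < ⋯ < n·ω < 1 < ⋯ < n`
(a 1-indexed descent at position `i` contributes `i`). -/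
def majG (π : GenPerm m n) : ℕ :=
  ∑ i ∈ Finset.range n, if h : i + 1 < n then
    (if (π.c ⟨i, by omega⟩).val < (π.c ⟨i + 1, h⟩).val ∨
        (π.c ⟨i, by omega⟩ = π.c ⟨i + 1, h⟩ ∧ π.σ ⟨i + 1, h⟩ < π.σ ⟨i, by omega⟩)
     then i + 1 else 0) else 0

/-- Coxeter length with respect to the generators `s 0, s 1, …, s (n-1)`. -/
noncomputable def len (π : GenPerm m n) : ℕ :=
  sInf {l | ∃ w : List (Fin n), w.length = l ∧ (w.map (fun i => (s (i : ℕ) : GenPerm m n))).prod = π}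


/-- `ω = exp(2πi/m)`. -/
noncomputable def omegaC (m : ℕ) : ℂ := Complex.exp (2 * Real.pi * Complex.I / m)

/-- The diagonal action of `g ∈ G = C_m ≀ S_n` on
`P_n^{⊗t} = ℂ[x_{i,j} : i ∈ [t], j ∈ [n]]`:  `x_{i,j} ↦ ω^{c_g(j)} x_{i, σ_g(j)}`. -/
noncomputable def actD {m n t : ℕ} (g : GenPerm m n) :
    MvPolynomial (Fin t × Fin n) ℂ →ₐ[ℂ] MvPolynomial (Fin t × Fin n) ℂ :=
  MvPolynomial.aeval (fun p : Fin t × Fin n =>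
    MvPolynomial.C (omegaC m ^ (g.c p.2).val) * MvPolynomial.X (p.1, g.σ p.2))

/-- The tensor action of `ḡ = (g_1,…,g_t) ∈ G^t` on `P_n^{⊗t}`:
`x_{i,j} ↦ ω^{c_{g_i}(j)} x_{i, σ_{g_i}(j)}`. -/
noncomputable def actT {m n t : ℕ} (gs : Fin t → GenPerm m n) :
    MvPolynomial (Fin t × Fin n) ℂ →ₐ[ℂ] MvPolynomial (Fin t × Fin n) ℂ :=
  MvPolynomial.aeval (fun p : Fin t × Fin n =>
    MvPolynomial.C (omegaC m ^ ((gs p.1).c p.2).val) * MvPolynomial.X (p.1, (gs p.1).σ p.2))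

/-- The diagonal invariant algebra `DIA`, as a submodule of `P_n^{⊗t}`. -/
noncomputable def DIAsub (m n t : ℕ) : Submodule ℂ (MvPolynomial (Fin t × Fin n) ℂ) :=
  ⨅ g : GenPerm m n, LinearMap.ker ((actD (t := t) g).toLinearMap - LinearMap.id)

/-- The tensor invariant algebra `TIA`, as a submodule of `P_n^{⊗t}`. -/
noncomputable def TIAsub (m n t : ℕ) : Submodule ℂ (MvPolynomial (Fin t × Fin n) ℂ) :=
  ⨅ gs : Fin t → GenPerm m n, LinearMap.ker ((actT gs).toLinearMap - LinearMap.id)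

/-- The homogeneous component of multidegree `d ∈ ℕ^t` of `P_n^{⊗t}`: the variable
`x_{i,j}` has multidegree the `i`-th standard basis vector. -/
noncomputable def multiHomog (m n t : ℕ) (d : Fin t →₀ ℕ) :
    Submodule ℂ (MvPolynomial (Fin t × Fin n) ℂ) :=
  MvPolynomial.weightedHomogeneousSubmodule ℂ
    (fun p : Fin t × Fin n => Finsupp.single p.1 1) d

/-- The Hilbert series `F_D` of the diagonal invariant algebra. -/
noncomputable def FD (m n t : ℕ) : MvPowerSeries (Fin t) ℚ :=
  fun d => (Module.finrank ℂ ↥(multiHomog m n t d ⊓ DIAsub m n t) : ℚ)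

/-- The Hilbert series `F_T` of the tensor invariant algebra. -/
noncomputable def FT (m n t : ℕ) : MvPowerSeries (Fin t) ℚ :=
  fun d => (Module.finrank ℂ ↥(multiHomog m n t d ⊓ TIAsub m n t) : ℚ)

section Part1

/-- The (coloured) standardization of a word over a linearly ordered, coloured alphabet. -/
def Srt {A : Type*} [LinearOrder A] (col : A → ZMod m) (w : Fin n → A) : GenPerm m n :=
  ⟨Tuple.sort (fun a => OrderDual.toDual (w a)),
    fun j => col (w (Tuple.sort (fun a => OrderDual.toDual (w a)) j))⟩

lemma eq_Srt_iff {A : Type*} [LinearOrder A] (col : A → ZMod m) (w : Fin n → A)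
    (g : GenPerm m n) :
    g = Srt col w ↔
      (∀ j j', j < j' → w (g.σ j') < w (g.σ j) ∨ (w (g.σ j') = w (g.σ j) ∧ g.σ j < g.σ j')) ∧
        ∀ j, g.c j = col (w (g.σ j)) := by
  have key : g.σ = Tuple.sort (fun a => OrderDual.toDual (w a)) ↔
      (∀ j j', j < j' → w (g.σ j') < w (g.σ j) ∨
        (w (g.σ j') = w (g.σ j) ∧ g.σ j < g.σ j')) := by
    rw [Tuple.eq_sort_iff]
    constructor
    · rintro ⟨h1, h2⟩ j j' hj
      have h3 : w (g.σ j') ≤ w (g.σ j) := h1 hj.le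
      rcases h3.lt_or_eq with h | h
      · exact Or.inl h
      · exact Or.inr ⟨h, h2 j j' hj (congrArg OrderDual.toDual h.symm)⟩
    · intro h
      refine ⟨?_, ?_⟩
      · rw [monotone_iff_forall_lt]
        intro j j' hj
        change w (g.σ j') ≤ w (g.σ j)
        rcases h j j' hj with h | h
        · exact h.le
        · exact h.1.le
      · intro j j' hj he
        have he' : w (g.σ j) = w (g.σ j') := he
        rcases h j j' hj with h | h
        · exact absurd he' h.ne'
        · exact h.2
  rw [← key]
  constructor
  · intro h
    subst h
    exact ⟨rfl, fun _ => rfl⟩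
  · rintro ⟨h1, h2⟩
    ext j
    · rw [h1]; rfl
    · rw [h2, h1]; rfl

lemma Srt_spec {A : Type*} [LinearOrder A] (col : A → ZMod m) (w : Fin n → A) :
    (∀ j j', j < j' → w ((Srt col w).σ j') < w ((Srt col w).σ j) ∨
      (w ((Srt col w).σ j') = w ((Srt col w).σ j) ∧ (Srt col w).σ j < (Srt col w).σ j')) ∧
        ∀ j, (Srt col w).c j = col (w ((Srt col w).σ j)) :=
  (eq_Srt_iff col w _).1 rfl

lemma Srt_eq_one_iff {A : Type*} [LinearOrder A] (col : A → ZMod m) (w : Fin n → A) :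
    Srt col w = 1 ↔ Antitone w ∧ ∀ j, col (w j) = 0 := by
  rw [eq_comm, eq_Srt_iff]
  simp only [one_σ, one_c, Equiv.Perm.one_apply]
  rw [antitone_iff_forall_lt]
  constructor
  · rintro ⟨h1, h2⟩
    refine ⟨fun j j' hj => ?_, fun j => (h2 j).symm⟩
    rcases h1 j j' hj with h | h
    · exact h.le
    · exact h.1.le
  · rintro ⟨h1, h2⟩
    refine ⟨fun j j' hj => ?_, fun j => (h2 j).symm⟩
    rcases (h1 hj).lt_or_eq with h | h
    · exact Or.inl h
    · exact Or.inr ⟨h, hj⟩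

lemma Srt_mul {A B C : Type*} [LinearOrder A] [LinearOrder B] [LinearOrder C]
    (colA : A → ZMod m) (colB : B → ZMod m) (colC : C → ZMod m)
    (f : Fin n → B) (w : Fin n → A) (x : Fin n → C)
    (hc : ∀ a, colC (x ((Srt colB f).σ a)) = colB (f ((Srt colB f).σ a)) + colA (w a))
    (hlt : ∀ a b, x ((Srt colB f).σ a) < x ((Srt colB f).σ b) ↔ w a < w b ∨
      (w a = w b ∧ f ((Srt colB f).σ a) < f ((Srt colB f).σ b)))
    (heq : ∀ a b, x ((Srt colB f).σ a) = x ((Srt colB f).σ b) ↔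
      (w a = w b ∧ f ((Srt colB f).σ a) = f ((Srt colB f).σ b))) :
    Srt colB f * Srt colA w = Srt colC x := by
  rw [eq_Srt_iff]
  obtain ⟨f1, f2⟩ := Srt_spec colB f
  obtain ⟨w1, w2⟩ := Srt_spec colA w
  constructor
  · intro j j' hj
    simp only [mul_σ, Equiv.Perm.mul_apply, hlt, heq]
    rcases w1 j j' hj with h | ⟨h, h'⟩
    · exact Or.inl (Or.inl h)
    · rcases f1 _ _ h' with h2 | ⟨h2, h3⟩
      · exact Or.inl (Or.inr ⟨h, h2⟩)
      · exact Or.inr ⟨⟨h, h2⟩, h3⟩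
  · intro j
    simp only [mul_σ, mul_c, Equiv.Perm.mul_apply, hc, f2, w2]

lemma colex_cons_lt {T : ℕ} (a b : ℕ) (u v : Fin T → ℕ) :
    toColex (Fin.cons a u : Fin (T + 1) → ℕ) < toColex (Fin.cons b v : Fin (T + 1) → ℕ) ↔
      toColex u < toColex v ∨ (u = v ∧ a < b) := by
  change (∃ i : Fin (T + 1), (∀ j, j > i → _) ∧ _) ↔ (∃ i : Fin T, (∀ j, j > i → _) ∧ _) ∨ _
  rw [Fin.exists_fin_succ]
  simp only [Fin.forall_fin_succ, Pi.toColex_apply, Fin.cons_zero, Fin.cons_succ]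
  simp only [gt_iff_lt, Fin.succ_lt_succ_iff, Fin.not_lt_zero, lt_self_iff_false, Fin.succ_pos,
    forall_true_left, IsEmpty.forall_iff, true_and, funext_iff]
  exact or_comm

/-- row colour -/
def rcol : ℕ → ZMod m := fun k => (k : ZMod m)

/-- column colour -/
def ccol {T : ℕ} : Colex (Fin T → ℕ) → ZMod m := fun v => ((∑ i, ofColex v i : ℕ) : ZMod m)

/-- columns of a matrix -/
def cols {T : ℕ} (h : Fin T → Fin n → ℕ) : Fin n → Colex (Fin T → ℕ) :=
  fun a => toColex (fun i => h i a)

lemma exists_matrix_equiv (m n T : ℕ) :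
    ∃ E : (Fin T → Fin n → ℕ) ≃ (Fin T → Fin n → ℕ),
      (∀ f i, ∑ a, E f i a = ∑ a, f i a) ∧
      ∀ f, (List.ofFn (fun i => (Srt rcol (f i) : GenPerm m n))).prod = Srt ccol (cols (E f)) := by
  induction T with
  | zero =>
    refine ⟨Equiv.refl _, fun f i => rfl, fun f => ?_⟩
    simp only [List.ofFn_zero, List.prod_nil]
    rw [eq_comm, Srt_eq_one_iff]
    refine ⟨fun a b _ => le_of_eq (Subsingleton.elim _ _), fun j => by
      unfold ccol; rw [Fin.sum_univ_zero]; simp⟩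
  | succ T ih =>
    obtain ⟨E, hE1, hE2⟩ := ih
    let p : (Fin n → ℕ) → Equiv.Perm (Fin n) := fun f => (Srt rcol f : GenPerm m n).σ
    refine ⟨{
      toFun := fun f => Fin.cons (f 0) (fun i a => E (Fin.tail f) i ((p (f 0))⁻¹ a))
      invFun := fun h => Fin.cons (h 0) (E.symm (fun i a => Fin.tail h i (p (h 0) a)))
      left_inv := ?_
      right_inv := ?_ }, ?_, ?_⟩
    · intro f
      have hq : ∀ a, (p (f 0))⁻¹ (p (f 0) a) = a := fun a => by simp
      simp only [Fin.cons_zero, Fin.tail_cons, hq]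
      change Fin.cons (f 0) (E.symm (E (Fin.tail f))) = f
      simp
    · intro f
      have hq : ∀ a, p (f 0) ((p (f 0))⁻¹ a) = a := fun a => by simp
      simp only [Fin.cons_zero, Fin.tail_cons, Equiv.apply_symm_apply, hq]
      change Fin.cons (f 0) (Fin.tail f) = f
      simp
    · intro f i
      simp only [Equiv.coe_fn_mk]
      refine Fin.cases ?_ (fun i => ?_) i
      · simp
      · simp only [Fin.cons_succ]
        rw [Equiv.sum_comp (p (f 0))⁻¹ (fun a => E (Fin.tail f) i a), hE1]
        rfl
    · intro f
      rw [List.ofFn_succ, List.prod_cons]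
      have := hE2 (Fin.tail f)
      simp only [Fin.tail] at this
      rw [this]
      have hx : ∀ a, cols (Fin.cons (f 0) (fun i a => E (Fin.tail f) i ((p (f 0))⁻¹ a)) :
          Fin (T + 1) → Fin n → ℕ) a = toColex (Fin.cons (f 0 a)
            (ofColex (cols (E (Fin.tail f)) ((p (f 0))⁻¹ a))) : Fin (T + 1) → ℕ) := by
        intro a
        simp only [cols]
        congr 1
        funext i
        refine Fin.cases ?_ (fun i => ?_) i <;> simp
      have hp : ∀ a, (p (f 0))⁻¹ ((Srt rcol (f 0) : GenPerm m n).σ a) = a := fun a => by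
        simp [p]
      apply Srt_mul
      · intro a
        simp only [Equiv.coe_fn_mk, hx, hp]
        simp [ccol, rcol, Fin.sum_univ_succ, cols, Fin.tail_def]
      · intro a b
        simp only [Equiv.coe_fn_mk, hx, hp]
        exact colex_cons_lt _ _ _ _
      · intro a b
        simp only [Equiv.coe_fn_mk, hx, hp]
        rw [toColex_inj, Fin.cons_inj]
        rw [and_comm]
        rfl

end Part1

section Part2

lemma t_zero : (t 0 : GenPerm m n) = s 0 := by
  simp [t]

lemma t_succ (i : ℕ) : (t (i + 1) : GenPerm m n) = s (i + 1) * t i := by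
  unfold t
  rw [List.range_succ_eq_map, List.map_cons, List.prod_cons, List.map_map]
  simp only [tsub_zero]
  congr 2
  apply List.map_congr_left
  intro a _
  simp

lemma t_spec (i : ℕ) (hi : i < n) (j : Fin n) :
    (((t i : GenPerm m n).σ j : Fin n) : ℕ) =
      (if (j : ℕ) = 0 then i else if (j : ℕ) ≤ i then (j : ℕ) - 1 else j) ∧
    (t i : GenPerm m n).c j = if (j : ℕ) = 0 then 1 else 0 := by
  induction i with
  | zero =>
    rw [t_zero]
    have : (s 0 : GenPerm m n) = ⟨1, fun j => if j = ⟨0, by omega⟩ then 1 else 0⟩ := by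
      simp [s, hi]
    rw [this]
    simp only [Equiv.Perm.one_apply, Fin.ext_iff]
    constructor
    · split_ifs <;> omega
    · trivial
  | succ i ih =>
    obtain ⟨h1, h2⟩ := ih (by omega)
    have hs : (s (i + 1) : GenPerm m n) = ⟨Equiv.swap ⟨i, by omega⟩ ⟨i + 1, hi⟩, 0⟩ := by
      simp [s, hi]
    rw [t_succ, hs]
    refine ⟨?_, ?_⟩
    · simp only [mul_σ, Equiv.Perm.mul_apply, Equiv.swap_apply_def]
      generalize (t i : GenPerm m n).σ j = x at h1
      simp only [Fin.ext_iff, apply_ite Fin.val]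
      split_ifs at h1 ⊢ <;> omega
    · simp only [mul_c, h2, Pi.zero_apply, zero_add]

lemma t_pow_spec (i : ℕ) (hi : i < n) (r : ℕ) (hr : r ≤ i + 1) (j : Fin n) :
    ((((t i : GenPerm m n) ^ r).σ j : Fin n) : ℕ) =
      (if (j : ℕ) ≤ i then (if r ≤ (j : ℕ) then (j : ℕ) - r else j + (i + 1) - r) else j) ∧
    ((t i : GenPerm m n) ^ r).c j = if (j : ℕ) < r then 1 else 0 := by
  induction r with
  | zero => simp
  | succ r ih =>
    obtain ⟨h1, h2⟩ := ih (by omega)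
    obtain ⟨h3, h4⟩ := t_spec (m := m) i hi (((t i : GenPerm m n) ^ r).σ j)
    rw [pow_succ']
    refine ⟨?_, ?_⟩
    · rw [mul_σ, Equiv.Perm.mul_apply, h3, h1]
      split_ifs <;> omega
    · rw [mul_c, h4, h1, h2]
      by_cases a1 : (j : ℕ) < r
      · have : (j : ℕ) < r + 1 := by omega
        simp only [a1, this, if_true]
        rw [if_neg, zero_add]
        split_ifs <;> omega
      · by_cases a2 : (j : ℕ) = r
        · have : (j : ℕ) < r + 1 := by omega
          simp only [a1, this, if_true, if_false]
          rw [if_pos, add_zero]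
          split_ifs <;> omega
        · have : ¬ (j : ℕ) < r + 1 := by omega
          simp only [a1, this, if_false]
          rw [if_neg, add_zero]
          split_ifs <;> omega

lemma t_pow_order (i : ℕ) (hi : i < n) : (t i : GenPerm m n) ^ (m * (i + 1)) = 1 := by
  rw [mul_comm, pow_mul]
  have h1 : ((t i : GenPerm m n) ^ (i + 1)).σ = 1 := by
    ext j
    rw [(t_pow_spec i hi (i + 1) le_rfl j).1]
    simp only [Equiv.Perm.one_apply]
    split_ifs <;> omega
  generalize (t i : GenPerm m n) ^ (i + 1) = g at h1
  have h2 : ∀ k : ℕ, (g ^ k).σ = 1 ∧ ∀ j, (g ^ k).c j = k * g.c j := by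
    intro k
    induction k with
    | zero => simp
    | succ k ih =>
      rw [pow_succ]
      refine ⟨by simp [ih.1, h1], fun j => ?_⟩
      rw [mul_c, ih.2, h1]
      simp only [Equiv.Perm.one_apply]
      push_cast
      ring
  ext j
  · rw [(h2 m).1]; rfl
  · rw [(h2 m).2]; simp

/-- partial product -/
def RR (K : ℕ → ℕ) : ℕ → GenPerm m n
  | 0 => 1
  | (i + 1) => t i ^ K i * RR K i

lemma RR_eq_list (K : ℕ → ℕ) (N : ℕ) :
    (List.ofFn (fun i : Fin N => (t (i : ℕ) : GenPerm m n) ^ K i)).reverse.prod = RR K N := by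
  induction N with
  | zero => simp [RR]
  | succ N ih =>
    rw [List.ofFn_succ', List.concat_eq_append, List.reverse_append]
    simp only [List.reverse_singleton, List.prod_append, List.prod_singleton, Fin.val_last,
      Fin.val_castSucc, ih, RR]

/-- extension of `K` by zero -/
def ext0 (K : Fin n → ℕ) : ℕ → ℕ := fun i => if h : i < n then K ⟨i, h⟩ else 0

lemma rep_eq_RR (K : Fin n → ℕ) : (rep K : GenPerm m n) = RR (ext0 K) n := by
  rw [← RR_eq_list]
  unfold rep ext0
  congr 3
  funext i
  simp

/-- The lift of `t i` to words. -/
def TT (m : ℕ) (i : ℕ) (f : Fin n → ℕ) : Fin n → ℕ := fun a =>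
  f ((t i : GenPerm m n).σ⁻¹ a) + if (((t i : GenPerm m n).σ⁻¹ a : Fin n) : ℕ) = 0 then 1 else 0

lemma TT_apply (i : ℕ) (f : Fin n → ℕ) (b : Fin n) :
    TT m i f ((t i : GenPerm m n).σ b) = f b + if (b : ℕ) = 0 then 1 else 0 := by
  simp [TT]

lemma TT_inj (i : ℕ) : Function.Injective (TT m i : (Fin n → ℕ) → _) := by
  intro f g h
  funext b
  have := congrFun h ((t i : GenPerm m n).σ b)
  rw [TT_apply, TT_apply] at this
  omega

lemma t_zero_pos (i : ℕ) (hi : i < n) : (t i : GenPerm m n).σ ⟨0, by omega⟩ = ⟨i, hi⟩ := by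
  apply Fin.ext
  rw [(t_spec i hi _).1]
  simp

lemma TT_pos (i : ℕ) (hi : i < n) (f : Fin n → ℕ) : 0 < TT m i f ⟨i, hi⟩ := by
  rw [← t_zero_pos (m := m) i hi, TT_apply]
  simp

lemma t_big (i : ℕ) (hi : i < n) (a : Fin n) (ha : i < (a : ℕ)) :
    (t i : GenPerm m n).σ a = a := by
  apply Fin.ext
  rw [(t_spec i hi _).1]
  split_ifs <;> omega

lemma TT_supp (i : ℕ) (hi : i < n) (f : Fin n → ℕ) (hf : ∀ a : Fin n, i < (a : ℕ) → f a = 0)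
    (a : Fin n) (ha : i < (a : ℕ)) : TT m i f a = 0 := by
  rw [← t_big (m := m) i hi a ha, TT_apply, hf a ha, if_neg (by omega)]

lemma TT_sum (i : ℕ) (hi : i < n) (f : Fin n → ℕ) : ∑ a, TT m i f a = ∑ a, f a + 1 := by
  rw [← Equiv.sum_comp (t i : GenPerm m n).σ]
  simp only [TT_apply, Finset.sum_add_distrib]
  congr 1
  rw [Finset.sum_eq_single (⟨0, by omega⟩ : Fin n)]
  · simp
  · intro b _ hb
    rw [if_neg]
    intro h
    exact hb (Fin.ext h)
  · simp

lemma Srt_TT (i : ℕ) (hi : i < n) (f : Fin n → ℕ) (hf : ∀ a : Fin n, i < (a : ℕ) → f a = 0) :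
    t i * Srt rcol f = (Srt rcol (TT m i f) : GenPerm m n) := by
  rw [eq_Srt_iff]
  obtain ⟨f1, f2⟩ := Srt_spec (m := m) rcol f
  constructor
  · intro j j' hj
    simp only [mul_σ, Equiv.Perm.mul_apply, TT_apply]
    have h := f1 j j' hj
    generalize (Srt (m := m) rcol f).σ j = a at h
    generalize (Srt (m := m) rcol f).σ j' = b at h
    have hfa := hf a
    have hfb := hf b
    simp only [Fin.lt_def] at h ⊢
    rw [(t_spec i hi a).1, (t_spec i hi b).1]
    split_ifs <;> omega
  · intro j
    simp only [mul_σ, mul_c, Equiv.Perm.mul_apply, TT_apply, f2, (t_spec i hi _).2]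
    simp only [rcol]
    push_cast
    ring

/-- The word attached to an exponent vector. -/
def BB (m : ℕ) (K : ℕ → ℕ) : ℕ → (Fin n → ℕ)
  | 0 => 0
  | (i + 1) => (TT m i)^[K i] (BB m K i)

lemma TT_iter (i : ℕ) (hi : i < n) (f : Fin n → ℕ) (hf : ∀ a : Fin n, i < (a : ℕ) → f a = 0)
    (k : ℕ) :
    (∀ a : Fin n, i < (a : ℕ) → (TT m i)^[k] f a = 0) ∧
    ∑ a, (TT m i)^[k] f a = ∑ a, f a + k ∧
    t i ^ k * Srt rcol f = (Srt rcol ((TT m i)^[k] f) : GenPerm m n) := by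
  induction k with
  | zero => simpa using hf
  | succ k ih =>
    obtain ⟨h1, h2, h3⟩ := ih
    rw [Function.iterate_succ_apply']
    refine ⟨TT_supp i hi _ h1, ?_, ?_⟩
    · rw [TT_sum i hi, h2]; ring
    · rw [pow_succ', mul_assoc, h3, Srt_TT i hi _ h1]

lemma BB_spec (K : ℕ → ℕ) (i : ℕ) (hi : i ≤ n) :
    (∀ a : Fin n, i ≤ (a : ℕ) → BB m K i a = 0) ∧
    ∑ a : Fin n, BB m K i a = ∑ j ∈ Finset.range i, K j ∧
    RR K i = (Srt rcol (BB m K i) : GenPerm m n) := by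
  induction i with
  | zero =>
    refine ⟨by simp [BB], by simp [BB], ?_⟩
    rw [eq_comm]
    simp only [BB, RR]
    rw [Srt_eq_one_iff]
    exact ⟨fun _ _ _ => le_rfl, fun j => by simp [rcol]⟩
  | succ i ih =>
    obtain ⟨h1, h2, h3⟩ := ih (by omega)
    obtain ⟨g1, g2, g3⟩ := TT_iter (m := m) i (by omega) (BB m K i) (fun a ha => h1 a ha.le) (K i)
    refine ⟨g1, ?_, ?_⟩
    · rw [Finset.sum_range_succ, ← h2]
      exact g2
    · rw [RR, h3, g3]
      rfl

lemma BB_congr (K K' : ℕ → ℕ) (i : ℕ) (h : ∀ j < i, K j = K' j) :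
    (BB m K i : Fin n → ℕ) = BB m K' i := by
  induction i with
  | zero => rfl
  | succ i ih =>
    rw [BB, BB, ih (fun j hj => h j (by omega)), h i (by omega)]

lemma TT_iter_aux (i : ℕ) (hi : i < n) (x y : Fin n → ℕ) (a b : ℕ) (hx : x ⟨i, hi⟩ = 0)
    (hab : a ≤ b) (h : (TT m i)^[a] x = (TT m i)^[b] y) : a = b ∧ x = y := by
  obtain ⟨c, rfl⟩ := Nat.exists_eq_add_of_le hab
  rw [Function.iterate_add_apply] at h
  have h' := (TT_inj (m := m) i).iterate a h
  rcases c with _ | c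
  · exact ⟨rfl, h'⟩
  · rw [Function.iterate_succ_apply'] at h'
    have := TT_pos (m := m) i hi ((TT m i)^[c] y)
    rw [← h'] at this
    omega

lemma BB_inj (K K' : ℕ → ℕ) (i : ℕ) (hi : i ≤ n) (h : (BB m K i : Fin n → ℕ) = BB m K' i) :
    ∀ j < i, K j = K' j := by
  induction i with
  | zero => intro j hj; omega
  | succ i ih =>
    rw [BB, BB] at h
    have h1 := (BB_spec (m := m) (n := n) K i (by omega)).1 ⟨i, by omega⟩ le_rfl
    have h2 := (BB_spec (m := m) (n := n) K' i (by omega)).1 ⟨i, by omega⟩ le_rfl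
    have key : K i = K' i ∧ (BB m K i : Fin n → ℕ) = BB m K' i := by
      rcases le_total (K i) (K' i) with hh | hh
      · exact TT_iter_aux i (by omega) _ _ _ _ h1 hh h
      · obtain ⟨p, q⟩ := TT_iter_aux i (by omega) _ _ _ _ h2 hh h.symm
        exact ⟨p.symm, q.symm⟩
    intro j hj
    rcases Nat.lt_succ_iff_lt_or_eq.1 hj with hj | rfl
    · exact ih (by omega) key.2 j hj
    · exact key.1

lemma BB_surj (i : ℕ) (hi : i ≤ n) (f : Fin n → ℕ) (hf : ∀ a : Fin n, i ≤ (a : ℕ) → f a = 0) :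
    ∃ K : ℕ → ℕ, BB m K i = f := by
  induction i generalizing f with
  | zero => exact ⟨0, funext fun a => (hf a (Nat.zero_le _)).symm⟩
  | succ i ih =>
    generalize hN : ∑ a, f a = N
    induction N generalizing f with
    | zero =>
      have hf0 : ∀ a, f a = 0 := by simpa using hN
      obtain ⟨K, hK⟩ := ih (by omega) f (fun a _ => hf0 a)
      refine ⟨Function.update K i 0, ?_⟩
      rw [BB, BB_congr _ K i]
      · simpa using hK
      · intro j hj
        rw [Function.update_of_ne (by omega)]
    | succ N ihN =>
      by_cases h0 : f ⟨i, by omega⟩ = 0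
      · obtain ⟨K, hK⟩ := ih (by omega) f (fun a ha => by
          rcases ha.lt_or_eq with h | h
          · exact hf a h
          · have : a = ⟨i, by omega⟩ := Fin.ext h.symm
            rw [this, h0])
        refine ⟨Function.update K i 0, ?_⟩
        rw [BB, BB_congr _ K i]
        · simpa using hK
        · intro j hj
          rw [Function.update_of_ne (by omega)]
      · let f' : Fin n → ℕ := fun b =>
          f ((t i : GenPerm m n).σ b) - if (b : ℕ) = 0 then 1 else 0
        have hT : TT m i f' = f := by
          funext a
          obtain ⟨b, rfl⟩ := (t i : GenPerm m n).σ.surjective a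
          rw [TT_apply]
          by_cases hb : (b : ℕ) = 0
          · have : b = ⟨0, by omega⟩ := Fin.ext hb
            simp only [f']
            rw [this, t_zero_pos (m := m) i (by omega : i < n)]
            simp
            omega
          · simp [f', hb]
        have hs := TT_sum (m := m) i (by omega) f'
        rw [hT, hN] at hs
        obtain ⟨K, hK⟩ := ihN f' (fun a ha => by
          simp only [f', t_big (m := m) i (by omega : i < n) a ha, hf a ha]
          simp) (by omega)
        refine ⟨Function.update K i (K i + 1), ?_⟩
        rw [BB, BB_congr _ K i]
        · rw [Function.update_self, Function.iterate_succ_apply', ← hT, ← hK]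
          rfl
        · intro j hj
          rw [Function.update_of_ne (by omega)]

lemma exists_row_equiv (m n : ℕ) :
    ∃ B : (Fin n → ℕ) ≃ (Fin n → ℕ), (∀ K, ∑ a, B K a = ∑ a, K a) ∧
      ∀ K, (Srt rcol (B K) : GenPerm m n) = rep K := by
  have hb1 : Function.Injective (fun K : Fin n → ℕ => (BB m (ext0 K) n : Fin n → ℕ)) := by
    intro K K' h
    have := BB_inj (ext0 K) (ext0 K') n le_rfl h
    funext j
    simpa [ext0] using this j j.2
  have hb2 : Function.Surjective (fun K : Fin n → ℕ => (BB m (ext0 K) n : Fin n → ℕ)) := by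
    intro f
    obtain ⟨K, hK⟩ := BB_surj (m := m) n le_rfl f (fun a ha => by omega)
    refine ⟨fun j => K j, ?_⟩
    simp only
    rw [← hK]
    apply BB_congr
    intro j hj
    simp [ext0, hj]
  have hb : Function.Bijective (fun K : Fin n → ℕ => (BB m (ext0 K) n : Fin n → ℕ)) := ⟨hb1, hb2⟩
  refine ⟨Equiv.ofBijective _ hb, ?_, ?_⟩
  · intro K
    rw [Equiv.ofBijective_apply, (BB_spec (m := m) (ext0 K) n le_rfl).2.1, ← Fin.sum_univ_eq_sum_range]
    simp [ext0]
  · intro K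
    rw [Equiv.ofBijective_apply, rep_eq_RR, (BB_spec (m := m) (ext0 K) n le_rfl).2.2]

lemma Srt_surj [NeZero m] (g : GenPerm m n) : ∃ f : Fin n → ℕ, Srt rcol f = g := by
  refine ⟨fun a => m * (n - (g.σ⁻¹ a : Fin n)) + (g.c (g.σ⁻¹ a)).val, ?_⟩
  rw [eq_comm, eq_Srt_iff]
  constructor
  · intro j j' hj
    left
    simp only [Equiv.Perm.inv_def, Equiv.symm_apply_apply]
    have h1 := ZMod.val_lt (g.c j')
    have h2 : n - (j : ℕ) = (n - (j' : ℕ)) + ((j' : ℕ) - j) := by omega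
    have h3 : m * 1 ≤ m * ((j' : ℕ) - j) := Nat.mul_le_mul_left _ (by omega)
    rw [h2, mul_add]
    omega
  · intro j
    simp [rcol]

lemma rep_surj [NeZero m] (g : GenPerm m n) : ∃ K : Fin n → ℕ, rep K = g := by
  obtain ⟨B, -, hB⟩ := exists_row_equiv m n
  obtain ⟨f, hf⟩ := Srt_surj g
  exact ⟨B.symm f, by rw [← hB, Equiv.apply_symm_apply, hf]⟩

lemma rep_mod (K : Fin n → ℕ) : (rep (fun i => K i % (m * ((i : ℕ) + 1))) : GenPerm m n) = rep K := by
  unfold rep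
  congr 3
  funext i
  exact (pow_eq_pow_mod _ (t_pow_order i i.2)).symm

lemma card_GenPerm [NeZero m] : Fintype.card (GenPerm m n) = ∏ i : Fin n, (m * ((i : ℕ) + 1)) := by
  have e : GenPerm m n ≃ Equiv.Perm (Fin n) × (Fin n → ZMod m) :=
    { toFun := fun g => (g.σ, g.c)
      invFun := fun p => ⟨p.1, p.2⟩
      left_inv := fun _ => rfl
      right_inv := fun _ => rfl }
  rw [Fintype.card_congr e, Fintype.card_prod, Fintype.card_perm, Finset.prod_mul_distrib,
    Fin.prod_univ_eq_prod_range (fun i => i + 1) n, Finset.prod_range_add_one_eq_factorial]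
  simp [ZMod.card, mul_comm]

lemma rep_box_inj [NeZero m] (k k' : Fin n → ℕ) (hk : ∀ i, k i < m * ((i : ℕ) + 1))
    (hk' : ∀ i, k' i < m * ((i : ℕ) + 1)) (h : (rep k : GenPerm m n) = rep k') : k = k' := by
  let F : (∀ i : Fin n, Fin (m * ((i : ℕ) + 1))) → GenPerm m n := fun x => rep (fun i => (x i : ℕ))
  have hm : 0 < m := Nat.pos_of_ne_zero (NeZero.ne m)
  have hF : Function.Bijective F := by
    rw [Fintype.bijective_iff_surjective_and_card]
    constructor
    · intro g
      obtain ⟨K, hK⟩ := rep_surj g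
      refine ⟨fun i => ⟨K i % (m * ((i : ℕ) + 1)), Nat.mod_lt _ (by positivity)⟩, ?_⟩
      rw [← hK, ← rep_mod K]
    · rw [card_GenPerm, Fintype.card_pi]
      simp
  have := @hF.1 (fun i => ⟨k i, hk i⟩) (fun i => ⟨k' i, hk' i⟩) h
  funext i
  simpa using congrFun this i

lemma exists_kk (m n : ℕ) [NeZero m] :
    ∃ kk : GenPerm m n → Fin n → ℕ, (∀ g, flagMajor g = ∑ i, kk g i) ∧
      ∀ g K, rep K = g ↔ ∃ L : Fin n → ℕ, (rep L : GenPerm m n) = 1 ∧ K = L + kk g := by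
  have hm : 0 < m := Nat.pos_of_ne_zero (NeZero.ne m)
  have hex : ∀ g : GenPerm m n,
      ∃ k : Fin n → ℕ, (∀ i : Fin n, k i < m * ((i : ℕ) + 1)) ∧ g = rep k := by
    intro g
    obtain ⟨K, hK⟩ := rep_surj g
    exact ⟨fun i => K i % (m * ((i : ℕ) + 1)), fun i => Nat.mod_lt _ (by positivity),
      by rw [rep_mod, hK]⟩
  have rep_zero : (rep 0 : GenPerm m n) = 1 := by
    rw [rep_eq_RR]
    have : ∀ i, (RR (ext0 (0 : Fin n → ℕ)) i : GenPerm m n) = 1 := by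
      intro i
      induction i with
      | zero => rfl
      | succ i ih => simp [RR, ih, ext0]
    exact this n
  have h1 : ∀ L : Fin n → ℕ, (rep L : GenPerm m n) = 1 ↔
      ∀ i, L i % (m * ((i : ℕ) + 1)) = 0 := by
    intro L
    rw [← rep_mod]
    constructor
    · intro h
      rw [← rep_zero] at h
      have := rep_box_inj _ _ (fun i => Nat.mod_lt _ (by positivity))
        (fun i => by simp; positivity) h
      intro i
      simpa using congrFun this i
    · intro h
      rw [← rep_zero]
      congr 1
      funext i
      exact h i
  refine ⟨fun g => (hex g).choose, fun g => ?_, fun g K => ?_⟩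
  · unfold flagMajor
    rw [dif_pos (hex g)]
  · have hs := (hex g).choose_spec
    beta_reduce
    generalize (hex g).choose = k at hs
    obtain ⟨hs1, hs2⟩ := hs
    constructor
    · intro h
      have : (fun i => K i % (m * ((i : ℕ) + 1))) = k := by
        apply rep_box_inj (m := m) _ _ (fun i => Nat.mod_lt _ (by positivity)) hs1
        rw [rep_mod, h, hs2]
      refine ⟨fun i => m * ((i : ℕ) + 1) * (K i / (m * ((i : ℕ) + 1))), ?_, ?_⟩
      · rw [h1]
        intro i
        simp
      · funext i
        rw [← this]
        exact (Nat.div_add_mod _ _).symm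
    · rintro ⟨L, hL, rfl⟩
      rw [h1] at hL
      rw [hs2, ← rep_mod]
      congr 1
      funext i
      rw [Pi.add_apply, Nat.add_mod, hL i, zero_add, Nat.mod_mod, Nat.mod_eq_of_lt (hs1 i)]

end Part2

section Part3

/-- The permutation of the variables induced by a tuple. -/
def eP {T : ℕ} (gs : Fin T → GenPerm m n) : Equiv.Perm (Fin T × Fin n) where
  toFun p := (p.1, (gs p.1).σ p.2)
  invFun p := (p.1, (gs p.1).σ.symm p.2)
  left_inv p := by simp
  right_inv p := by simp

/-- The induced map on exponents. -/
noncomputable def mv {T : ℕ} (gs : Fin T → GenPerm m n) (μ : Fin T × Fin n →₀ ℕ) :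
    Fin T × Fin n →₀ ℕ := Finsupp.mapDomain (eP gs) μ

lemma mv_apply {T : ℕ} (gs : Fin T → GenPerm m n) (μ : Fin T × Fin n →₀ ℕ) (i : Fin T)
    (a : Fin n) : mv gs μ (i, (gs i).σ a) = μ (i, a) :=
  Finsupp.mapDomain_apply (eP gs).injective μ (i, a)

lemma mv_inj {T : ℕ} (gs : Fin T → GenPerm m n) : Function.Injective (mv gs) :=
  Finsupp.mapDomain_injective (eP gs).injective

/-- The scalar. -/
noncomputable def chi {T : ℕ} (gs : Fin T → GenPerm m n) (μ : Fin T × Fin n →₀ ℕ) : ℂ :=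
  ∏ p, (omegaC m ^ ((gs p.1).c p.2).val) ^ μ p

lemma omegaC_prim [NeZero m] : IsPrimitiveRoot (omegaC m) m :=
  Complex.isPrimitiveRoot_exp m (NeZero.ne m)

lemma chi_ne_zero [NeZero m] {T : ℕ} (gs : Fin T → GenPerm m n) (μ : Fin T × Fin n →₀ ℕ) :
    chi gs μ ≠ 0 := by
  unfold chi
  rw [Finset.prod_ne_zero_iff]
  intro p _
  exact pow_ne_zero _ (pow_ne_zero _ (omegaC_prim.ne_zero (NeZero.ne m)))

lemma chi_eq_one_iff [NeZero m] {T : ℕ} (gs : Fin T → GenPerm m n) (μ : Fin T × Fin n →₀ ℕ) :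
    chi gs μ = 1 ↔ ∑ i, ∑ a, (gs i).c a * (μ (i, a) : ZMod m) = 0 := by
  unfold chi
  simp only [← pow_mul]
  rw [Finset.prod_pow_eq_pow_sum, omegaC_prim.pow_eq_one_iff_dvd, ← ZMod.natCast_eq_zero_iff,
    Fintype.sum_prod_type]
  push_cast
  simp

lemma actT_monomial {T : ℕ} (gs : Fin T → GenPerm m n) (μ : Fin T × Fin n →₀ ℕ) (a : ℂ) :
    actT gs (MvPolynomial.monomial μ a) = MvPolynomial.monomial (mv gs μ) (chi gs μ * a) := by
  unfold actT
  rw [MvPolynomial.aeval_monomial, MvPolynomial.monomial_eq, Finsupp.prod_fintype _ _ (by simp),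
    Finsupp.prod_fintype _ _ (by simp),
    ← Equiv.prod_comp (eP gs) (fun p => MvPolynomial.X p ^ mv gs μ p)]
  simp only [mul_pow, Finset.prod_mul_distrib, ← MvPolynomial.C_pow]
  have : ∀ p, mv gs μ (eP gs p) = μ p := fun p => Finsupp.mapDomain_apply (eP gs).injective μ p
  simp only [this]
  rw [← map_prod, chi, map_mul, MvPolynomial.algebraMap_eq]
  simp only [eP, Equiv.coe_fn_mk]
  ring

lemma coeff_actT {T : ℕ} (gs : Fin T → GenPerm m n) (μ : Fin T × Fin n →₀ ℕ)
    (p : MvPolynomial (Fin T × Fin n) ℂ) :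
    MvPolynomial.coeff (mv gs μ) (actT gs p) = chi gs μ * MvPolynomial.coeff μ p := by
  classical
  induction p using MvPolynomial.induction_on' with
  | monomial u a =>
    rw [actT_monomial, MvPolynomial.coeff_monomial, MvPolynomial.coeff_monomial]
    by_cases h : u = μ
    · subst h; simp
    · rw [if_neg h, if_neg (fun h' => h (mv_inj gs h'))]; simp
  | add p q hp hq =>
    rw [map_add, MvPolynomial.coeff_add, MvPolynomial.coeff_add, hp, hq, mul_add]

lemma omegaC_pow_add [NeZero m] (a b : ZMod m) :
    omegaC m ^ (a + b).val = omegaC m ^ a.val * omegaC m ^ b.val := by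
  rw [ZMod.val_add, ← pow_add]
  exact (pow_eq_pow_mod _ omegaC_prim.pow_eq_one).symm

lemma actT_mul [NeZero m] {T : ℕ} (gs hs : Fin T → GenPerm m n)
    (p : MvPolynomial (Fin T × Fin n) ℂ) : actT (gs * hs) p = actT gs (actT hs p) := by
  have : actT (gs * hs) = (actT gs).comp (actT hs) := by
    apply MvPolynomial.algHom_ext
    intro p
    simp only [actT, MvPolynomial.aeval_X, AlgHom.comp_apply, map_mul, Pi.mul_apply, mul_σ, mul_c,
      Equiv.Perm.mul_apply, omegaC_pow_add, MvPolynomial.algHom_C, MvPolynomial.algebraMap_eq]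
    ring
  rw [this]; rfl

lemma weight_iff {T : ℕ} (d : Fin T →₀ ℕ) (μ : Fin T × Fin n →₀ ℕ) :
    Finsupp.weight (fun p : Fin T × Fin n => (Finsupp.single p.1 1 : Fin T →₀ ℕ)) μ = d ↔
      ∀ i, ∑ a, μ (i, a) = d i := by
  classical
  rw [Finsupp.weight_apply, Finsupp.sum_fintype _ _ (by simp), Fintype.sum_prod_type,
    DFunLike.ext_iff]
  refine forall_congr' fun i => ?_
  rw [Finsupp.finsetSum_apply]
  simp only [Finsupp.finsetSum_apply, Finsupp.smul_apply, Finsupp.single_apply]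
  rw [Finset.sum_eq_single i]
  · simp
  · intro b _ hb
    simp [hb]
  · simp

lemma mv_rows {T : ℕ} (gs : Fin T → GenPerm m n) (μ : Fin T × Fin n →₀ ℕ) (i : Fin T) :
    ∑ a, mv gs μ (i, a) = ∑ a, μ (i, a) := by
  rw [← Equiv.sum_comp (gs i).σ]
  simp only [mv_apply]

/-- The rows condition. -/
def Rows {T : ℕ} (d : Fin T →₀ ℕ) (h : Fin T → Fin n → ℕ) : Prop := ∀ i, ∑ a, h i a = d i

lemma finite_Rows {T : ℕ} (d : Fin T →₀ ℕ) : {h : Fin T → Fin n → ℕ | Rows d h}.Finite := by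
  apply Set.Finite.subset (Set.finite_Iic (fun i _ => d i : Fin T → Fin n → ℕ))
  intro h hh i a
  beta_reduce
  rw [← hh i]
  exact Finset.single_le_sum (f := fun a => h i a) (fun _ _ => Nat.zero_le _) (Finset.mem_univ a)

/-- matrix of an exponent -/
def mat {T : ℕ} (μ : Fin T × Fin n →₀ ℕ) : Fin T → Fin n → ℕ := fun i a => μ (i, a)

/-- exponents and matrices -/
noncomputable def matEquiv {T : ℕ} : (Fin T × Fin n →₀ ℕ) ≃ (Fin T → Fin n → ℕ) :=
  Finsupp.equivFunOnFinite.trans (Equiv.curry _ _ _)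

lemma matEquiv_apply {T : ℕ} (μ : Fin T × Fin n →₀ ℕ) : matEquiv μ = mat μ := rfl

lemma inv_finrank [NeZero m] {T : ℕ} {H : Type} [Fintype H] [Group H]
    (ψ : H →* (Fin T → GenPerm m n)) (d : Fin T →₀ ℕ) (C : Set (Fin T → Fin n → ℕ))
    (hC : ∀ h ∈ C, Rows d h)
    (h1 : ∀ μ : Fin T × Fin n →₀ ℕ, Rows d (mat μ) →
      (∃ h, mv (ψ h) μ = μ ∧ chi (ψ h) μ ≠ 1) ∨ ∃ h, mat (mv (ψ h) μ) ∈ C)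
    (h2 : ∀ μ : Fin T × Fin n →₀ ℕ, mat μ ∈ C → ∀ h, mat (mv (ψ h) μ) ∈ C →
      mv (ψ h) μ = μ ∧ chi (ψ h) μ = 1) :
    Module.finrank ℂ ↥(multiHomog m n T d ⊓
      ⨅ h : H, LinearMap.ker ((actT (ψ h)).toLinearMap - LinearMap.id)) = Nat.card C := by
  classical
  set V := multiHomog m n T d ⊓
      ⨅ h : H, LinearMap.ker ((actT (ψ h)).toLinearMap - LinearMap.id) with hV
  have memV : ∀ p, p ∈ V ↔ (∀ μ, MvPolynomial.coeff μ p ≠ 0 → Rows d (mat μ)) ∧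
      ∀ h, actT (ψ h) p = p := by
    intro p
    rw [hV, Submodule.mem_inf, Submodule.mem_iInf, multiHomog,
      MvPolynomial.mem_weightedHomogeneousSubmodule]
    simp only [LinearMap.mem_ker, LinearMap.sub_apply, AlgHom.toLinearMap_apply, LinearMap.id_apply,
      sub_eq_zero, MvPolynomial.IsWeightedHomogeneous, weight_iff]
    rfl
  have : Finite C := ((finite_Rows d).subset hC).to_subtype
  have := Fintype.ofFinite C
  let Φ : V →ₗ[ℂ] (C → ℂ) := LinearMap.pi (fun c =>
    (MvPolynomial.lcoeff ℂ (matEquiv.symm (c : Fin T → Fin n → ℕ))).comp V.subtype)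
  have hΦ : ∀ p c, Φ p c = MvPolynomial.coeff (matEquiv.symm (c : Fin T → Fin n → ℕ)) p.1 :=
    fun _ _ => rfl
  have hinj : Function.Injective Φ := by
    rw [← LinearMap.ker_eq_bot, LinearMap.ker_eq_bot']
    rintro ⟨p, hp⟩ h0
    obtain ⟨hp1, hp2⟩ := (memV p).1 hp
    have hz : ∀ μ, mat μ ∈ C → MvPolynomial.coeff μ p = 0 := by
      intro μ hμ
      have := congrFun h0 ⟨mat μ, hμ⟩
      rw [hΦ] at this
      simpa [← matEquiv_apply] using this
    ext μ
    simp only [MvPolynomial.coeff_zero, ZeroMemClass.coe_zero]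
    by_contra hne
    rcases h1 μ (hp1 μ hne) with ⟨h, e1, e2⟩ | ⟨h, e1⟩
    · have := coeff_actT (ψ h) μ p
      rw [e1, hp2] at this
      apply e2
      have h3 : (chi (ψ h) μ - 1) * MvPolynomial.coeff μ p = 0 := by
        rw [sub_mul, ← this]; ring
      rcases mul_eq_zero.1 h3 with h4 | h4
      · exact sub_eq_zero.1 h4
      · exact absurd h4 hne
    · have := coeff_actT (ψ h) μ p
      rw [hp2, hz _ e1] at this
      exact mul_ne_zero (chi_ne_zero _ _) hne this.symm
  have hsurj : Function.Surjective Φ := by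
    intro v
    let M : C → (Fin T × Fin n →₀ ℕ) := fun c => matEquiv.symm c
    have hM : ∀ c, mat (M c) = c := fun c => by rw [← matEquiv_apply]; simp [M]
    let N : C → ℂ := fun c => ((Finset.univ.filter (fun h : H => mv (ψ h) (M c) = M c)).card : ℂ)
    have hN : ∀ c, N c ≠ 0 := by
      intro c
      simp only [N]
      rw [Nat.cast_ne_zero, Finset.card_ne_zero]
      refine ⟨1, ?_⟩
      simp only [Finset.mem_filter, Finset.mem_univ, true_and, map_one]
      ext ⟨i, a⟩
      exact mv_apply (1 : Fin T → GenPerm m n) (M c) i a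
    let q : MvPolynomial (Fin T × Fin n) ℂ := ∑ c, MvPolynomial.monomial (M c) (v c / N c)
    let p : MvPolynomial (Fin T × Fin n) ℂ := ∑ h : H, actT (ψ h) q
    have hpq : p = ∑ h : H, ∑ c, MvPolynomial.monomial (mv (ψ h) (M c))
        (chi (ψ h) (M c) * (v c / N c)) := by
      simp only [p, q, map_sum, actT_monomial]
    have hp : p ∈ V := by
      rw [memV]
      constructor
      · intro μ hμ
        rw [hpq, MvPolynomial.coeff_sum] at hμ
        obtain ⟨h, -, hh⟩ := Finset.exists_ne_zero_of_sum_ne_zero hμ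
        rw [MvPolynomial.coeff_sum] at hh
        obtain ⟨c, -, hc⟩ := Finset.exists_ne_zero_of_sum_ne_zero hh
        rw [MvPolynomial.coeff_monomial] at hc
        have : mv (ψ h) (M c) = μ := by
          by_contra hcc
          rw [if_neg hcc] at hc
          exact hc rfl
        rw [← this]
        intro i
        have h3 := mv_rows (ψ h) (M c) i
        have h4 := hC c c.2 i
        rw [← hM c] at h4
        exact h3.trans h4
      · intro h
        simp only [p, map_sum, ← actT_mul, ← map_mul]
        exact Fintype.sum_equiv (Equiv.mulLeft h) _ _ (fun k => rfl)
    refine ⟨⟨p, hp⟩, ?_⟩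
    funext c
    rw [hΦ]
    change MvPolynomial.coeff (M c) p = v c
    rw [hpq]
    simp only [MvPolynomial.coeff_sum, MvPolynomial.coeff_monomial]
    have : ∀ h : H, (∑ c', if mv (ψ h) (M c') = M c then chi (ψ h) (M c') * (v c' / N c') else 0) =
        if mv (ψ h) (M c) = M c then v c / N c else 0 := by
      intro h
      have key : ∀ c', mv (ψ h) (M c') = M c → c' = c ∧ chi (ψ h) (M c') = 1 := by
        intro c' hc'
        obtain ⟨e1, e2⟩ := h2 (M c') (by rw [hM]; exact c'.2) h (by rw [hc', hM]; exact c.2)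
        refine ⟨?_, e2⟩
        rw [hc'] at e1
        apply Subtype.ext
        rw [← hM c', ← e1, hM]
      rw [Finset.sum_eq_single c]
      · split_ifs with hh
        · rw [(key c hh).2, one_mul]
        · rfl
      · intro c' _ hne
        rw [if_neg (fun hh => hne (key c' hh).1)]
      · simp
    simp only [this]
    rw [← Finset.sum_filter, Finset.sum_const, nsmul_eq_mul]
    exact mul_div_cancel₀ _ (hN c)
  rw [(LinearEquiv.ofBijective Φ ⟨hinj, hsurj⟩).finrank_eq, Module.finrank_fintype_fun_eq_card,
    Nat.card_eq_fintype_card]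

lemma perm_antitone_eq {A : Type*} [PartialOrder A] (w w' : Fin n → A) (σ : Equiv.Perm (Fin n))
    (hw : Antitone w) (hw' : Antitone w') (h : ∀ a, w' (σ a) = w a) : w' = w := by
  have e : w' ∘ σ = w := funext h
  have := Tuple.unique_antitone (f := w') (σ := σ) (τ := 1) (by rw [e]; exact hw) (by simpa using hw')
  rw [e] at this
  rw [this]
  rfl

lemma Srt_antitone {A : Type*} [LinearOrder A] (col : A → ZMod m) (w : Fin n → A) :
    Antitone (fun j => w ((Srt col w).σ j)) := by
  rw [antitone_iff_forall_lt]
  intro j j' hj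
  rcases (Srt_spec col w).1 j j' hj with h | h
  · exact h.le
  · exact h.1.le

lemma FD_coeff [NeZero m] (T : ℕ) (d : Fin T →₀ ℕ) :
    FD m n T d = Nat.card {h : Fin T → Fin n → ℕ | Rows d h ∧
      (Srt ccol (cols h) : GenPerm m n) = 1} := by
  unfold FD
  congr 1
  refine inv_finrank (Pi.constMonoidHom (Fin T) (GenPerm m n)) d _ (fun h hh => hh.1) ?_ ?_
  · intro μ hμ
    by_cases hz : ∀ a, (ccol (cols (mat μ) a) : ZMod m) = 0
    · right
      set σ := (Srt (m := m) ccol (cols (mat μ))).σ with hσ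
      refine ⟨⟨σ⁻¹, 0⟩, ?_, ?_⟩
      · intro i
        exact (mv_rows _ μ i).trans (hμ i)
      · have e : ∀ j, cols (mat (mv (Pi.constMonoidHom (Fin T) (GenPerm m n) ⟨σ⁻¹, 0⟩) μ)) j =
            cols (mat μ) (σ j) := by
          intro j
          unfold cols mat
          congr 1
          funext i
          rw [← mv_apply (Pi.constMonoidHom (Fin T) (GenPerm m n) ⟨σ⁻¹, 0⟩) μ i (σ j)]
          simp
        rw [Srt_eq_one_iff]
        refine ⟨?_, fun j => by rw [e, hz]⟩
        rw [funext e]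
        exact Srt_antitone ccol (cols (mat μ))
    · left
      push Not at hz
      obtain ⟨b, hb⟩ := hz
      refine ⟨⟨1, Pi.single b 1⟩, ?_, ?_⟩
      · ext ⟨i, a⟩
        exact mv_apply (Pi.constMonoidHom (Fin T) (GenPerm m n) ⟨1, Pi.single b 1⟩) μ i a
      · rw [Ne, chi_eq_one_iff]
        intro h0
        apply hb
        rw [← h0]
        simp [ccol, cols, mat, Pi.single_apply]
  · intro μ hμ g hg
    have hμ2 := (Srt_eq_one_iff _ _).1 hμ.2
    have hg2 := (Srt_eq_one_iff _ _).1 hg.2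
    constructor
    · have := perm_antitone_eq _ _ g.σ hμ2.1 hg2.1 (fun a => by
        unfold cols mat
        congr 1
        funext i
        exact mv_apply (Pi.constMonoidHom (Fin T) (GenPerm m n) g) μ i a)
      ext ⟨i, a⟩
      exact congrFun (toColex_inj.1 (congrFun this a)) i
    · rw [chi_eq_one_iff, Finset.sum_comm]
      apply Finset.sum_eq_zero
      intro a _
      have h3 := hμ2.2 a
      simp only [Pi.constMonoidHom_apply, Function.const_apply]
      rw [← Finset.mul_sum]
      have h4 : (∑ i, (μ (i, a) : ZMod m)) = 0 := by
        rw [← h3]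
        simp [ccol, cols, mat]
      rw [h4, mul_zero]

lemma FT_coeff [NeZero m] (T : ℕ) (d : Fin T →₀ ℕ) :
    FT m n T d = Nat.card {h : Fin T → Fin n → ℕ | Rows d h ∧
      ∀ i, (Srt rcol (h i) : GenPerm m n) = 1} := by
  classical
  unfold FT
  congr 1
  refine inv_finrank (MonoidHom.id (Fin T → GenPerm m n)) d _ (fun h hh => hh.1) ?_ ?_
  · intro μ hμ
    by_cases hz : ∀ i a, (rcol (mat μ i a) : ZMod m) = 0
    · right
      let σ : Fin T → Equiv.Perm (Fin n) := fun i => (Srt (m := m) rcol (mat μ i)).σ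
      refine ⟨fun i => ⟨(σ i)⁻¹, 0⟩, ?_, ?_⟩
      · intro i
        exact (mv_rows _ μ i).trans (hμ i)
      · intro i
        have e : ∀ j, mat (mv (fun i => (⟨(σ i)⁻¹, 0⟩ : GenPerm m n)) μ) i j =
            mat μ i (σ i j) := by
          intro j
          unfold mat
          rw [← mv_apply (fun i => (⟨(σ i)⁻¹, 0⟩ : GenPerm m n)) μ i (σ i j)]
          simp
        rw [Srt_eq_one_iff]
        simp only [MonoidHom.id_apply]
        refine ⟨?_, fun j => by rw [e, hz]⟩
        rw [funext e]
        exact Srt_antitone rcol (mat μ i)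
    · left
      push Not at hz
      obtain ⟨k, b, hb⟩ := hz
      refine ⟨fun i => ⟨1, if i = k then Pi.single b 1 else 0⟩, ?_, ?_⟩
      · ext ⟨i, a⟩
        exact mv_apply (fun i => (⟨1, if i = k then Pi.single b 1 else 0⟩ : GenPerm m n)) μ i a
      · rw [Ne, chi_eq_one_iff]
        intro h0
        apply hb
        rw [← h0]
        simp only [MonoidHom.id_apply]
        rw [Finset.sum_eq_single k]
        · simp [rcol, mat, Pi.single_apply]
        · intro i _ hi
          simp [hi]
        · simp
  · intro μ hμ g hg
    have hμ2 := fun i => (Srt_eq_one_iff _ _).1 (hμ.2 i)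
    have hg2 := fun i => (Srt_eq_one_iff _ _).1 (hg.2 i)
    constructor
    · ext ⟨i, a⟩
      have := perm_antitone_eq _ _ (g i).σ (hμ2 i).1 (hg2 i).1 (fun a => mv_apply g μ i a)
      exact congrFun this a
    · rw [chi_eq_one_iff]
      apply Finset.sum_eq_zero
      intro i _
      apply Finset.sum_eq_zero
      intro a _
      have h3 : (μ (i, a) : ZMod m) = 0 := (hμ2 i).2 a
      rw [h3, mul_zero]

end Part3

section Part4

lemma FD_count [NeZero m] (T : ℕ) (d : Fin T →₀ ℕ) :
    FD m n T d = Nat.card {K : Fin T → Fin n → ℕ | Rows d K ∧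
      (List.ofFn (fun i => (rep (K i) : GenPerm m n))).prod = 1} := by
  rw [FD_coeff]
  congr 1
  obtain ⟨E, hE1, hE2⟩ := exists_matrix_equiv m n T
  obtain ⟨B, hB1, hB2⟩ := exists_row_equiv m n
  symm
  refine Nat.card_congr (Equiv.subtypeEquiv ((Equiv.piCongrRight (fun _ => B)).trans E) ?_)
  intro K
  have h1 : ∀ i, ∑ a, E (fun i => B (K i)) i a = ∑ a, K i a := fun i => by rw [hE1, hB1]
  have h2 := hE2 (fun i => B (K i))
  simp only [hB2] at h2
  change (Rows d K ∧ _) ↔ (Rows d (E (fun i => B (K i))) ∧ Srt ccol (cols (E (fun i => B (K i)))) = 1)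
  rw [← h2]
  simp only [Rows, h1]

lemma FT_count [NeZero m] (T : ℕ) (d : Fin T →₀ ℕ) :
    FT m n T d = Nat.card {K : Fin T → Fin n → ℕ | Rows d K ∧
      ∀ i, (rep (K i) : GenPerm m n) = 1} := by
  rw [FT_coeff]
  congr 1
  obtain ⟨B, hB1, hB2⟩ := exists_row_equiv m n
  symm
  refine Nat.card_congr (Equiv.subtypeEquiv (Equiv.piCongrRight (fun _ => B)) ?_)
  intro K
  change (Rows d K ∧ _) ↔ (Rows d (fun i => B (K i)) ∧ ∀ i, Srt rcol (B (K i)) = 1)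
  simp only [Rows, hB1, hB2]

lemma fiber_count [NeZero m] (T : ℕ) (d : Fin T →₀ ℕ) (gs : Fin T → GenPerm m n) :
    (Nat.card {K : Fin T → Fin n → ℕ | Rows d K ∧ ∀ i, rep (K i) = gs i} : ℚ) =
      MvPowerSeries.coeff d (FT m n T *
        ∏ i : Fin T, (MvPowerSeries.X i : MvPowerSeries (Fin T) ℚ) ^ flagMajor (gs i)) := by
  classical
  obtain ⟨kk, hk1, hk2⟩ := exists_kk m n
  simp only [MvPowerSeries.X_pow_eq]
  rw [MvPowerSeries.prod_monomial, MvPowerSeries.coeff_mul_monomial]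
  set e : Fin T →₀ ℕ := ∑ i, Finsupp.single i (flagMajor (gs i)) with he
  have he' : ∀ i, e i = ∑ a, kk (gs i) a := by
    intro i
    rw [he, Finsupp.finsetSum_apply, ← hk1]
    simp [Finsupp.single_apply]
  have hrow : ∀ (L : Fin T → Fin n → ℕ) i, ∑ a, (L i + kk (gs i)) a = ∑ a, L i a + e i := by
    intro L i
    rw [he']
    simp only [Pi.add_apply, Finset.sum_add_distrib]
  split_ifs with hle
  · simp only [Finset.prod_const_one, mul_one]
    change _ = FT m n T (d - e)
    rw [FT_count]
    congr 1
    symm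
    refine Nat.card_congr (Equiv.ofBijective
      (fun L => ⟨fun i => L.1 i + kk (gs i), ?_, ?_⟩) ⟨?_, ?_⟩)
    · intro i
      rw [hrow, L.2.1 i, Finsupp.tsub_apply]
      exact Nat.sub_add_cancel (hle i)
    · intro i
      exact (hk2 _ _).2 ⟨L.1 i, L.2.2 i, rfl⟩
    · rintro ⟨L, hL⟩ ⟨L', hL'⟩ h
      apply Subtype.ext
      funext i
      have := congrFun (congrArg Subtype.val h) i
      exact add_right_cancel this
    · rintro ⟨K, hK1, hK2⟩
      choose L hL1 hL2 using fun i => (hk2 _ _).1 (hK2 i)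
      refine ⟨⟨L, ?_, hL1⟩, ?_⟩
      · intro i
        have h3 := hK1 i
        rw [hL2 i, hrow] at h3
        rw [Finsupp.tsub_apply]
        omega
      · apply Subtype.ext
        funext i
        exact (hL2 i).symm
  · rw [Nat.cast_eq_zero, Nat.card_eq_zero]
    left
    constructor
    rintro ⟨K, hK1, hK2⟩
    apply hle
    intro i
    obtain ⟨L, -, hL⟩ := (hk2 _ _).1 (hK2 i)
    rw [← hK1 i, hL, hrow (fun _ => L) i]
    omega

lemma sum_fibers [NeZero m] (T : ℕ) (d : Fin T →₀ ℕ)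
    (P : (Fin T → GenPerm m n) → Prop) [DecidablePred P] :
    Nat.card {K : Fin T → Fin n → ℕ | Rows d K ∧ P (fun i => rep (K i))} =
      ∑ gs ∈ Finset.univ.filter P,
        Nat.card {K : Fin T → Fin n → ℕ | Rows d K ∧ ∀ i, rep (K i) = gs i} := by
  classical
  have h0 : ∀ Q : (Fin T → Fin n → ℕ) → Prop,
      Nat.card {K : Fin T → Fin n → ℕ | Rows d K ∧ Q K} =
        ((finite_Rows (n := n) d).toFinset.filter Q).card := by
    intro Q
    apply Nat.subtype_card
    intro K
    simp
  rw [h0 (fun K => P (fun i => rep (K i))),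
    Finset.card_eq_sum_card_fiberwise (f := fun K i => (rep (K i) : GenPerm m n))
      (t := Finset.univ.filter P)]
  · apply Finset.sum_congr rfl
    intro gs hgs
    rw [h0 (fun K => ∀ i, rep (K i) = gs i), Finset.filter_filter]
    congr 1
    ext K
    simp only [Finset.mem_filter, ← funext_iff]
    refine and_congr_right fun _ => ?_
    constructor
    · exact fun h => h.2
    · intro h
      refine ⟨?_, h⟩
      rw [h]
      exact (Finset.mem_filter.1 hgs).2
  · intro K hK
    have hK' := hK
    simp only [Finset.coe_filter, Set.mem_setOf_eq] at hK'
    simpa using hK'.2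

end Part4

open scoped Classical in
/-- Theorem 4.1:
`F_D(q̄) / F_T(q̄) = Σ_{π_1 ⋯ π_t = 1} Π_{i=1}^t q_i^{flag-major(π_i)}`,
the sum over all `t`-tuples of elements of `G = C_m ≀ S_n` whose product is the
identity (stated multiplied through by `F_T`). -/
theorem hilbert_series_quotient (m n t : ℕ) (hm : 0 < m) [NeZero m] :
    FD m n t =
      FT m n t *
        ∑ gs ∈ Finset.univ.filter
            (fun gs : Fin t → GenPerm m n => (List.ofFn gs).prod = 1),
          ∏ i : Fin t, (MvPowerSeries.X i : MvPowerSeries (Fin t) ℚ) ^ flagMajor (gs i) := by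
  ext d
  rw [Finset.mul_sum, map_sum]
  change FD m n t d = _
  rw [FD_count, sum_fibers t d (fun gs : Fin t → GenPerm m n => (List.ofFn gs).prod = 1)]
  push_cast
  exact Finset.sum_congr rfl (fun gs _ => fiber_count t d gs)

end GenPerm
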